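/- Under the gradient descent setup (f nonnegative C² with f(x₀) > 0; 4 f(x₀) < (1−ε)² r² α with α = α(x₀,r) and ε ∈ (0,1); L₁, L₂ bounds on first derivatives on B(x₀,r) and second derivatives on B(x₀,2r); η ≤ min{ r/(L₁√p), 2ε/(L₂ p) }; x_{j+1} := x_j − η∇f(x_j)), suppose k ≥ 1 and x₀, …, x_{k−1} ∈ B(x₀,r). Then for all 0 ≤ j ≤ k−1, Σ_{l=j}^{k−1} η |∇f(x_l)| ≤ (1 − (1−ε)αη)^{j/2} · √(4 f(x₀) / (α(1−ε)²)). -/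

import Mathlib

open Set Filter Metric

/-- Second order Taylor bound on `[0, 1]`. -/
theorem taylor_le_of_second_deriv_le {g g₁ g₂ : ℝ → ℝ} {M : ℝ}
    (hg : ∀ t, HasDerivAt g (g₁ t) t) (hg₁ : ∀ t, HasDerivAt g₁ (g₂ t) t)
    (hM : ∀ t ∈ Set.Icc (0 : ℝ) 1, g₂ t ≤ M) :
    g 1 ≤ g 0 + g₁ 0 + M / 2 := by
  have h₁ : ∀ t ∈ Set.Icc (0 : ℝ) 1, g₁ t ≤ g₁ 0 + M * t := by
    have hB : ∀ t, HasDerivAt (fun t => g₁ 0 + M * t) M t := fun t => by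
      simpa using ((hasDerivAt_id t).const_mul M).const_add (g₁ 0)
    intro t ht
    exact image_le_of_deriv_right_le_deriv_boundary
      (fun t _ => (hg₁ t).continuousAt.continuousWithinAt)
      (fun t _ => (hg₁ t).hasDerivWithinAt) (by simp)
      (fun t _ => (hB t).continuousAt.continuousWithinAt)
      (fun t _ => (hB t).hasDerivWithinAt)
      (fun t ht => hM t (Set.Ico_subset_Icc_self ht)) ht
  have hB : ∀ t, HasDerivAt (fun t => g 0 + (g₁ 0 * t + M / 2 * t ^ 2)) (g₁ 0 + M * t) t := by
    intro t
    have h := (((hasDerivAt_id t).const_mul (g₁ 0)).add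
      ((hasDerivAt_pow 2 t).const_mul (M / 2))).const_add (g 0)
    refine h.congr_deriv ?_
    norm_num
    ring
  have h := image_le_of_deriv_right_le_deriv_boundary
    (fun t _ => (hg t).continuousAt.continuousWithinAt)
    (fun t _ => (hg t).hasDerivWithinAt) (by simp)
    (fun t _ => (hB t).continuousAt.continuousWithinAt)
    (fun t _ => (hB t).hasDerivWithinAt)
    (fun t ht => h₁ t (Set.Ico_subset_Icc_self ht)) (Set.right_mem_Icc.2 (zero_le_one' ℝ))
  linarith

theorem EuclideanSpace.map_eq_sum_mul_single {p : ℕ} (A : EuclideanSpace ℝ (Fin p) →L[ℝ] ℝ)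
    (v : EuclideanSpace ℝ (Fin p)) :
    A v = ∑ i, v i * A (EuclideanSpace.single i 1) := by
  conv_lhs => rw [← (EuclideanSpace.basisFun (Fin p) ℝ).sum_repr v]
  simp

theorem norm_gradient_le_mul_sqrt {p : ℕ} {f : EuclideanSpace ℝ (Fin p) → ℝ}
    {z : EuclideanSpace ℝ (Fin p)} {L : ℝ} (hL₀ : 0 ≤ L)
    (hL : ∀ i : Fin p, |fderiv ℝ f z (EuclideanSpace.single i 1)| ≤ L) :
    ‖gradient f z‖ ≤ L * √p := by
  have hcoord : ∀ i, gradient f z i = fderiv ℝ f z (EuclideanSpace.single i 1) := by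
    intro i
    rw [← inner_gradient_left, EuclideanSpace.inner_single_right]
    simp
  rw [EuclideanSpace.norm_eq]
  have : ∑ i, ‖gradient f z i‖ ^ 2 ≤ ∑ _i : Fin p, L ^ 2 :=
    Finset.sum_le_sum fun i _ => by
      rw [hcoord]
      exact pow_le_pow_left₀ (norm_nonneg _) (hL i) 2
  refine (Real.sqrt_le_sqrt this).trans_eq ?_
  simp [mul_comm, Real.sqrt_mul, Real.sqrt_sq hL₀]

theorem le_add_fderiv_add_of_second_partials_le {p : ℕ} {f : EuclideanSpace ℝ (Fin p) → ℝ}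
    (hf : ContDiff ℝ 2 f) {y v : EuclideanSpace ℝ (Fin p)} {L : ℝ} (hL₀ : 0 ≤ L)
    (hL : ∀ t ∈ Set.Icc (0 : ℝ) 1, ∀ i j : Fin p,
      |fderiv ℝ (fun w => fderiv ℝ f w (EuclideanSpace.single i 1)) (y + t • v)
        (EuclideanSpace.single j 1)| ≤ L) :
    f (y + v) ≤ f y + fderiv ℝ f y v + L * p * ‖v‖ ^ 2 / 2 := by
  have hline : ∀ t : ℝ, HasDerivAt (fun t : ℝ => y + t • v) v t := fun t => by
    simpa using ((hasDerivAt_id t).smul_const v).const_add y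
  have hd : ∀ i : Fin p, Differentiable ℝ
      (fun w => fderiv ℝ f w (EuclideanSpace.single i (1 : ℝ))) := fun i =>
    ((hf.fderiv_right (m := 1) (by norm_num)).differentiable (by norm_num)).clm_apply
      (differentiable_const _)
  have hg : ∀ t : ℝ, HasDerivAt (fun t : ℝ => f (y + t • v)) (fderiv ℝ f (y + t • v) v) t :=
    fun t => ((hf.differentiable (by norm_num)) _).hasFDerivAt.comp_hasDerivAt t (hline t)
  have hg₁ : ∀ t : ℝ, HasDerivAt (fun t : ℝ => fderiv ℝ f (y + t • v) v)
      (∑ i, v i * fderiv ℝ (fun w => fderiv ℝ f w (EuclideanSpace.single i 1)) (y + t • v) v)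
      t := by
    intro t
    simp_rw [fun s : ℝ => EuclideanSpace.map_eq_sum_mul_single (fderiv ℝ f (y + s • v)) v]
    exact HasDerivAt.fun_sum fun i _ =>
      (((hd i) _).hasFDerivAt.comp_hasDerivAt t (hline t)).const_mul (v i)
  have hsum : (∑ i, |v i|) ^ 2 ≤ p * ‖v‖ ^ 2 := by
    have h := sq_sum_le_card_mul_sum_sq (s := Finset.univ) (f := fun i => |v i|)
    simpa [EuclideanSpace.norm_sq_eq] using h
  have hM : ∀ t ∈ Set.Icc (0 : ℝ) 1,
      ∑ i, v i * fderiv ℝ (fun w => fderiv ℝ f w (EuclideanSpace.single i 1)) (y + t • v) v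
        ≤ L * p * ‖v‖ ^ 2 := by
    intro t ht
    have hi : ∀ i, v i * fderiv ℝ (fun w => fderiv ℝ f w (EuclideanSpace.single i 1))
        (y + t • v) v ≤ |v i| * (L * ∑ j, |v j|) := by
      intro i
      refine (le_abs_self _).trans ?_
      rw [abs_mul]
      refine mul_le_mul_of_nonneg_left ?_ (abs_nonneg _)
      rw [EuclideanSpace.map_eq_sum_mul_single]
      refine (Finset.abs_sum_le_sum_abs _ _).trans ?_
      rw [Finset.mul_sum]
      refine Finset.sum_le_sum fun j _ => ?_
      rw [abs_mul, mul_comm L]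
      exact mul_le_mul_of_nonneg_left (hL t ht i j) (abs_nonneg _)
    refine (Finset.sum_le_sum fun i _ => hi i).trans ?_
    rw [← Finset.sum_mul]
    nlinarith [mul_le_mul_of_nonneg_left hsum hL₀]
  simpa using taylor_le_of_second_deriv_le hg hg₁ hM

/-- One step of the path length estimate: a decrease of `a` controls the step length `η * G`. -/
theorem mul_le_sqrt_sub_sqrt {a b G η δ α : ℝ} (ha : 0 ≤ a) (hb : 0 ≤ b) (hG : 0 ≤ G)
    (hη : 0 < η) (hδ : 0 < δ) (hα : 0 < α)
    (hdec : b ≤ a - η * δ * G ^ 2) (hlow : α * a ≤ G ^ 2) :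
    η * G ≤ 2 / (δ * √α) * (√a - √b) := by
  have hsα : 0 < √α := Real.sqrt_pos.2 hα
  have hba : b ≤ a := by nlinarith [mul_pos hη hδ, sq_nonneg G]
  have hsqrt : √b ≤ √a := Real.sqrt_le_sqrt hba
  have hsa := Real.sq_sqrt ha
  have hsb := Real.sq_sqrt hb
  have hsb₀ := Real.sqrt_nonneg b
  rcases hG.eq_or_lt with rfl | hG
  · have : 0 ≤ √a - √b := sub_nonneg.2 hsqrt
    rw [mul_zero]
    positivity
  have hGa : √α * √a ≤ G := by
    rw [← Real.sqrt_mul hα.le]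
    exact Real.sqrt_le_iff.2 ⟨hG.le, hlow⟩
  rw [div_mul_eq_mul_div, le_div_iff₀ (by positivity)]
  have ha' : 0 < √a := by
    refine Real.sqrt_pos.2 ?_
    nlinarith [mul_pos (mul_pos hη hδ) (pow_pos hG 2)]
  have h₁ : η * δ * G * (√α * √a) ≤ η * δ * G * G :=
    mul_le_mul_of_nonneg_left hGa (by positivity)
  refine le_of_mul_le_mul_right ?_ ha'
  nlinarith [mul_nonneg (sub_nonneg.2 hsqrt) (sub_nonneg.2 hsqrt)]

/-- **Lemma 4.5.** In the gradient descent setup, if `x₀, …, x_{k−1} ∈ B(x₀,r)`, then for all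
`0 ≤ j ≤ k−1`,
`Σ_{l=j}^{k−1} η ‖∇f(x_l)‖ ≤ (1 − (1−ε)αη)^{j/2} √(4 f(x₀) / (α(1−ε)²))`. -/
theorem gd_step_sum_bound
    {p : ℕ} (hp : 0 < p)
    (f : EuclideanSpace ℝ (Fin p) → ℝ)
    (hf : ContDiff ℝ 2 f) (hf0 : ∀ x, 0 ≤ f x)
    (x₀ : EuclideanSpace ℝ (Fin p)) (r : ℝ) (hr : 0 < r)
    (hfx₀ : 0 < f x₀)
    (α : ℝ)
    (hα : ∀ x ∈ Metric.closedBall x₀ r, f x ≠ 0 → α * f x ≤ ‖gradient f x‖ ^ 2)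
    (ε : ℝ) (hε : ε ∈ Set.Ioo (0:ℝ) 1)
    (hmainε : 4 * f x₀ < (1 - ε) ^ 2 * r ^ 2 * α)
    (L₁ L₂ : ℝ)
    (hL₁ : ∀ z ∈ Metric.closedBall x₀ r, ∀ i : Fin p,
      |fderiv ℝ f z (EuclideanSpace.single i 1)| ≤ L₁)
    (hL₂ : ∀ z ∈ Metric.closedBall x₀ (2 * r), ∀ i j : Fin p,
      |fderiv ℝ (fun v => fderiv ℝ f v (EuclideanSpace.single i 1)) z
        (EuclideanSpace.single j 1)| ≤ L₂)
    (η : ℝ) (hη : 0 < η)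
    (hηle : η ≤ min (r / (L₁ * Real.sqrt p)) (2 * ε / (L₂ * p)))
    (x : ℕ → EuclideanSpace ℝ (Fin p)) (hx0 : x 0 = x₀)
    (hxrec : ∀ j : ℕ, x (j + 1) = x j - η • gradient f (x j))
    (k : ℕ) (hk : 1 ≤ k)
    (hball : ∀ j < k, x j ∈ Metric.closedBall x₀ r) :
    ∀ j < k,
      ∑ l ∈ Finset.Ico j k, η * ‖gradient f (x l)‖
        ≤ Real.sqrt ((1 - (1 - ε) * α * η) ^ j) *
            Real.sqrt (4 * f x₀ / (α * (1 - ε) ^ 2)) := by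
  obtain ⟨hε₀, hε₁⟩ := hε
  have hδ : 0 < 1 - ε := by linarith
  have hα₀ : 0 < α := by
    have : 0 < (1 - ε) ^ 2 * r ^ 2 * α := by linarith
    exact pos_of_mul_pos_right this (by positivity)
  have hp' : (0 : ℝ) < p := by exact_mod_cast hp
  have hη₁ : 0 < r / (L₁ * √p) := hη.trans_le (hηle.trans (min_le_left _ _))
  have hη₂ : 0 < 2 * ε / (L₂ * p) := hη.trans_le (hηle.trans (min_le_right _ _))
  have hL₁p : 0 < L₁ * √p := (div_pos_iff_of_pos_left hr).1 hη₁
  have hL₂p : 0 < L₂ * p := (div_pos_iff_of_pos_left (by positivity)).1 hη₂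
  have hL₁₀ : 0 < L₁ := pos_of_mul_pos_left hL₁p (Real.sqrt_nonneg _)
  have hL₂₀ : 0 < L₂ := pos_of_mul_pos_left hL₂p hp'.le
  have hηL₁ : η * (L₁ * √p) ≤ r := (le_div_iff₀ hL₁p).1 (hηle.trans (min_le_left _ _))
  have hηL₂ : η * (L₂ * p) ≤ 2 * ε := (le_div_iff₀ hL₂p).1 (hηle.trans (min_le_right _ _))
  have hdec : ∀ l < k, f (x (l + 1)) ≤ f (x l) - η * (1 - ε) * ‖gradient f (x l)‖ ^ 2 := by
    intro l hl
    have hstep : ‖-(η • gradient f (x l))‖ ≤ r := by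
      rw [norm_neg, norm_smul, Real.norm_of_nonneg hη.le]
      exact (mul_le_mul_of_nonneg_left (norm_gradient_le_mul_sqrt hL₁₀.le
        (hL₁ _ (hball l hl))) hη.le).trans hηL₁
    have htaylor := le_add_fderiv_add_of_second_partials_le hf (y := x l)
      (v := -(η • gradient f (x l))) hL₂₀.le (fun t ht => hL₂ _ (by
        have hx := hball l hl
        rw [mem_closedBall_iff_norm] at hx ⊢
        have hsmul : ‖t • (-(η • gradient f (x l)))‖ ≤ r := by
          rw [norm_smul, Real.norm_of_nonneg ht.1]
          exact (mul_le_of_le_one_left (norm_nonneg _) ht.2).trans hstep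
        rw [add_sub_right_comm]
        linarith [norm_add_le (x l - x₀) (t • (-(η • gradient f (x l))))]))
    have hinner : fderiv ℝ f (x l) (-(η • gradient f (x l))) = -(η * ‖gradient f (x l)‖ ^ 2) := by
      rw [← inner_gradient_left, inner_neg_right, real_inner_smul_right,
        real_inner_self_eq_norm_sq]
    rw [hinner, ← sub_eq_add_neg, ← hxrec, norm_neg, norm_smul, Real.norm_of_nonneg hη.le]
      at htaylor
    nlinarith [mul_le_mul_of_nonneg_right hηL₂
      (mul_nonneg hη.le (sq_nonneg ‖gradient f (x l)‖))]
  have hlow : ∀ l < k, α * f (x l) ≤ ‖gradient f (x l)‖ ^ 2 := by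
    intro l hl
    by_cases h : f (x l) = 0
    · rw [h, mul_zero]
      positivity
    · exact hα _ (hball l hl) h
  have hcontr : ∀ l < k, f (x (l + 1)) ≤ (1 - (1 - ε) * α * η) * f (x l) := by
    intro l hl
    nlinarith [hdec l hl, mul_le_mul_of_nonneg_left (hlow l hl) (mul_pos hη hδ).le]
  have hq : 0 ≤ 1 - (1 - ε) * α * η := by
    have h := (hf0 _).trans (hcontr 0 hk)
    rw [hx0] at h
    exact nonneg_of_mul_nonneg_left h hfx₀
  have hgeom : ∀ l < k, f (x l) ≤ (1 - (1 - ε) * α * η) ^ l * f x₀ := by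
    intro l
    induction l with
    | zero => simp [hx0]
    | succ l ih =>
      intro hl
      have hl' : l < k := by omega
      rw [pow_succ', mul_assoc]
      exact (hcontr l hl').trans (mul_le_mul_of_nonneg_left (ih hl') hq)
  intro j hj
  have hC : 0 < 2 / ((1 - ε) * √α) := by positivity
  calc ∑ l ∈ Finset.Ico j k, η * ‖gradient f (x l)‖
      ≤ ∑ l ∈ Finset.Ico j k, 2 / ((1 - ε) * √α) * (√(f (x l)) - √(f (x (l + 1)))) :=
        Finset.sum_le_sum fun l hl =>
          have hlk := (Finset.mem_Ico.1 hl).2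
          mul_le_sqrt_sub_sqrt (hf0 _) (hf0 _) (norm_nonneg _) hη hδ hα₀ (hdec l hlk)
            (hlow l hlk)
    _ = 2 / ((1 - ε) * √α) * (√(f (x j)) - √(f (x k))) := by
        rw [← Finset.mul_sum]
        congr 1
        have h := Finset.sum_Ico_sub (fun l => √(f (x l))) hj.le
        rw [← neg_sub (√(f (x k))), ← h, ← Finset.sum_neg_distrib]
        simp
    _ ≤ 2 / ((1 - ε) * √α) * √((1 - (1 - ε) * α * η) ^ j * f x₀) := by
        refine mul_le_mul_of_nonneg_left ?_ hC.le
        linarith [Real.sqrt_nonneg (f (x k)), Real.sqrt_le_sqrt (hgeom j hj)]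
    _ = √((1 - (1 - ε) * α * η) ^ j) * √(4 * f x₀ / (α * (1 - ε) ^ 2)) := by
        rw [Real.sqrt_mul (pow_nonneg hq j), Real.sqrt_div (by positivity),
          Real.sqrt_mul hα₀.le, Real.sqrt_sq hδ.le, Real.sqrt_mul (by norm_num),
          show (4 : ℝ) = 2 ^ 2 by norm_num, Real.sqrt_sq (by norm_num)]
        ring
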